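/- Let F be the fermionic Fock space of the bc-system with the operators L_m, W̃_m and subspaces F^l, F̄^l defined in the context. For every l ∈ ℤ, there exists no linear subspace U ⊆ F^l such that L_m(U) ⊆ U and W̃_m(U) ⊆ U for all m ∈ ℤ and F^l = F̄^l ⊕ U. (That is, the short exact sequence 0 → F̄^l → F^l → F̄^{l−1} → 0 of modules over the W_3 algebra with central charge −2 does not split.) -/

import Mathlib

noncomputable section

open ExteriorAlgebra

/-- Index type for the basis of `V`: `Sum.inl n` corresponds to `v_n` (`n ≥ 0`),
and `Sum.inr n` corresponds to `w_{n+1}` (so the `w_k` for `k ≥ 1`). -/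
abbrev BCIndex : Type := ℕ ⊕ ℕ

/-- The vector space `V` with basis `{v_n : n ≥ 0} ∪ {w_n : n ≥ 1}`. -/
abbrev BCSpace : Type := BCIndex →₀ ℂ

/-- The fermionic Fock space: the exterior algebra of `V`. -/
abbrev FockF : Type := ExteriorAlgebra ℂ BCSpace

/-- The basis vector of `V` with index `i`. -/
def bv (i : BCIndex) : BCSpace := Finsupp.single i 1

/-- The linear functional sending the basis vector `i` to `1` and all others to `0`. -/
def bvDual (i : BCIndex) : Module.Dual ℂ BCSpace := Finsupp.lapply i

/-- The operator `b(n)`: for `n ≤ 0` left exterior multiplication by `v_{-n}`,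
for `n ≥ 1` contraction with the functional dual to `w_n`. -/
def bOp (n : ℤ) : Module.End ℂ FockF :=
  if n ≤ 0 then LinearMap.mulLeft ℂ (ι ℂ (bv (Sum.inl (-n).toNat)))
  else CliffordAlgebra.contractLeft (bvDual (Sum.inr (n - 1).toNat))

/-- The operator `c(n)`: for `n ≥ 0` contraction with the functional dual to `v_n`,
for `n ≤ -1` left exterior multiplication by `w_{-n}`. -/
def cOp (n : ℤ) : Module.End ℂ FockF :=
  if 0 ≤ n then CliffordAlgebra.contractLeft (bvDual (Sum.inl n.toNat))
  else LinearMap.mulLeft ℂ (ι ℂ (bv (Sum.inr (-n - 1).toNat)))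

/-- The normally ordered product `:b(k)c(j):`. -/
def nbc (k j : ℤ) : Module.End ℂ FockF :=
  if 1 ≤ k ∧ j ≤ -1 then -(cOp j ∘ₗ bOp k) else bOp k ∘ₗ cOp j

/-- The Virasoro modes `L_m` of `T(z) = :∂b(z)c(z):`,
`L_m x = Σ_k (−k)·:b(k)c(m−k):·x` (a finite sum on each `x`). -/
def Lmode (m : ℤ) (x : FockF) : FockF :=
  ∑ᶠ k : ℤ, (-k : ℂ) • nbc k (m - k) x

/-- The modes `W̃_m` of `W̃(z) = (1/2)(:∂²b(z)c(z): − :∂b(z)∂c(z):)`,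
`W̃_m x = (1/2)Σ_k k(2k−m)·:b(k)c(m−k):·x` (a finite sum on each `x`). -/
def Wmode (m : ℤ) (x : FockF) : FockF :=
  ∑ᶠ k : ℤ, ((1 / 2 : ℂ) * k * (2 * k - m)) • nbc k (m - k) x

/-- The charge of a list of basis indices: (number of `v`-type) − (number of `w`-type). -/
def chargeOf (L : List BCIndex) : ℤ :=
  (L.countP Sum.isLeft : ℤ) - (L.countP Sum.isRight : ℤ)

/-- `F^l`: the span of the wedge monomials of charge `l`. -/
def FF (l : ℤ) : Submodule ℂ FockF :=
  Submodule.span ℂ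
    {x | ∃ L : List BCIndex, chargeOf L = l ∧ x = (L.map fun i => ι ℂ (bv i)).prod}

/-- `F̄^l = {x ∈ F^l : c(0)x = 0}`. -/
def FFbar (l : ℤ) : Submodule ℂ FockF := FF l ⊓ LinearMap.ker (cOp 0)

theorem bOp_of_nonpos (n : ℕ) (x : FockF) : bOp (-n) x = ι ℂ (bv (Sum.inl n)) * x := by
  simp [bOp]

theorem bOp_of_pos (n : ℕ) :
    bOp (n + 1) = CliffordAlgebra.contractLeft (bvDual (Sum.inr n)) := by
  have h : ¬ ((n : ℤ) + 1 ≤ 0) := by omega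
  simp [bOp, h]

theorem cOp_of_nonneg (n : ℕ) :
    cOp n = CliffordAlgebra.contractLeft (bvDual (Sum.inl n)) := by
  simp [cOp]

theorem cOp_of_neg (n : ℕ) (x : FockF) : cOp (-(n + 1)) x = ι ℂ (bv (Sum.inr n)) * x := by
  have h : ¬ (0 ≤ -((n : ℤ) + 1)) := by omega
  rw [cOp, if_neg h]
  simp

theorem int_cases_nonpos (m : ℤ) : (∃ n : ℕ, m = -n) ∨ ∃ n : ℕ, m = n + 1 := by
  rcases le_or_gt m 0 with h | h
  · exact Or.inl ⟨(-m).toNat, by omega⟩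
  · exact Or.inr ⟨(m - 1).toNat, by omega⟩

theorem int_cases_nonneg (m : ℤ) : (∃ n : ℕ, m = n) ∨ ∃ n : ℕ, m = -(n + 1) := by
  rcases le_or_gt 0 m with h | h
  · exact Or.inl ⟨m.toNat, by omega⟩
  · exact Or.inr ⟨(-m - 1).toNat, by omega⟩

theorem ι_mul_ι_mul_swap (u v : BCSpace) (x : FockF) :
    ι ℂ u * (ι ℂ v * x) = -(ι ℂ v * (ι ℂ u * x)) := by
  rw [← mul_assoc, ← mul_assoc, eq_neg_iff_add_eq_zero, ← add_mul, ι_add_mul_swap, zero_mul]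

theorem contractLeft_ι_mul (d : Module.Dual ℂ BCSpace) (u : BCSpace) (x : FockF) :
    CliffordAlgebra.contractLeft d (ι ℂ u * x) =
      d u • x - ι ℂ u * CliffordAlgebra.contractLeft d x :=
  CliffordAlgebra.contractLeft_ι_mul d u x

theorem contractLeft_swap (d d' : Module.Dual ℂ BCSpace) (x : FockF) :
    CliffordAlgebra.contractLeft d (CliffordAlgebra.contractLeft d' x) =
      -CliffordAlgebra.contractLeft d' (CliffordAlgebra.contractLeft d x) :=
  CliffordAlgebra.contractLeft_comm (Q := 0) d d' x

theorem bvDual_bv (i j : BCIndex) : bvDual i (bv j) = if j = i then 1 else 0 := by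
  simp [bvDual, bv, Finsupp.single_apply]

theorem bOp_bOp_swap (m n : ℤ) (x : FockF) : bOp m (bOp n x) = -bOp n (bOp m x) := by
  obtain ⟨m, rfl⟩ | ⟨m, rfl⟩ := int_cases_nonpos m <;>
  obtain ⟨n, rfl⟩ | ⟨n, rfl⟩ := int_cases_nonpos n <;>
  simp only [bOp_of_nonpos, bOp_of_pos, contractLeft_ι_mul, bvDual_bv, reduceCtorEq, if_false,
    zero_smul, zero_sub, neg_neg]
  · exact ι_mul_ι_mul_swap _ _ _
  · exact contractLeft_swap _ _ _

theorem cOp_cOp_swap (m n : ℤ) (x : FockF) : cOp m (cOp n x) = -cOp n (cOp m x) := by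
  obtain ⟨m, rfl⟩ | ⟨m, rfl⟩ := int_cases_nonneg m <;>
  obtain ⟨n, rfl⟩ | ⟨n, rfl⟩ := int_cases_nonneg n <;>
  simp only [cOp_of_nonneg, cOp_of_neg, contractLeft_ι_mul, bvDual_bv, reduceCtorEq, if_false,
    zero_smul, zero_sub, neg_neg]
  · exact contractLeft_swap _ _ _
  · exact ι_mul_ι_mul_swap _ _ _

theorem cOp_bOp_swap (n m : ℤ) (x : FockF) :
    cOp n (bOp m x) = (if m = -n then x else 0) - bOp m (cOp n x) := by
  obtain ⟨m, rfl⟩ | ⟨m, rfl⟩ := int_cases_nonpos m <;>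
  obtain ⟨n, rfl⟩ | ⟨n, rfl⟩ := int_cases_nonneg n <;>
  simp only [bOp_of_nonpos, bOp_of_pos, cOp_of_nonneg, cOp_of_neg, contractLeft_ι_mul, bvDual_bv,
    ite_smul, one_smul, zero_smul, Sum.inl.injEq, Sum.inr.injEq, neg_inj, Nat.cast_inj]
  · rw [if_neg (by omega), zero_sub, ι_mul_ι_mul_swap]
  · rw [if_neg (by omega), zero_sub, contractLeft_swap]
  · simp only [neg_neg, add_left_inj, Nat.cast_inj, eq_comm (a := n)]
    abel

theorem nbc_apply (k j : ℤ) (x : FockF) :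
    nbc k j x = bOp k (cOp j x) - (if 1 ≤ k ∧ k = -j then x else 0) := by
  unfold nbc
  split_ifs with h₁ h₂ h₂
  · simp [cOp_bOp_swap, h₂.2]
  · simp [cOp_bOp_swap, show k ≠ -j from fun h => h₂ ⟨h₁.1, h⟩]
  · omega
  · simp

theorem nbc_bOp (k j r : ℤ) (x : FockF) :
    nbc k j (bOp r x) = bOp r (nbc k j x) + if r = -j then bOp k x else 0 := by
  simp only [nbc_apply, cOp_bOp_swap, map_sub, apply_ite (bOp _), map_zero]
  rw [bOp_bOp_swap k r]
  abel

theorem nbc_cOp (k j r : ℤ) (x : FockF) :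
    nbc k j (cOp r x) = cOp r (nbc k j x) - if k = -r then cOp j x else 0 := by
  simp only [nbc_apply, cOp_bOp_swap, map_sub, apply_ite (cOp _), map_zero]
  rw [cOp_cOp_swap j r, map_neg]
  abel

theorem bOp_one (k : ℤ) (hk : 1 ≤ k) : bOp k 1 = 0 := by
  rw [bOp, if_neg (by omega)]
  exact CliffordAlgebra.contractLeft_one (Q := 0) _

theorem cOp_one (k : ℤ) (hk : 0 ≤ k) : cOp k 1 = 0 := by
  rw [cOp, if_pos hk]
  exact CliffordAlgebra.contractLeft_one (Q := 0) _

theorem nbc_one (k j : ℤ) (h : 1 ≤ k ∨ 0 ≤ j) : nbc k j 1 = 0 := by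
  unfold nbc
  split_ifs with h₁
  · simp [bOp_one k h₁.1]
  · have hj : 0 ≤ j := by omega
    simp [cOp_one j hj]

/-- The Fock space is generated from the vacuum by the operators `b(n)` and `c(n)`. -/
theorem fock_induction {P : FockF → Prop} (one : P 1)
    (add : ∀ x y, P x → P y → P (x + y)) (smul : ∀ (a : ℂ) x, P x → P (a • x))
    (b : ∀ n x, P x → P (bOp n x)) (c : ∀ n x, P x → P (cOp n x)) (x : FockF) : P x := by
  induction x using CliffordAlgebra.left_induction with
  | algebraMap r => rw [Algebra.algebraMap_eq_smul_one]; exact smul _ _ one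
  | add x y hx hy => exact add _ _ hx hy
  | ι_mul x m hx =>
    change P (ι ℂ m * x)
    induction m using Finsupp.induction_linear with
    | zero => simpa using smul 0 _ hx
    | add u v hu hv => rw [map_add, add_mul]; exact add _ _ hu hv
    | single i a =>
      have h : Finsupp.single i a = a • bv i := by simp [bv]
      rw [h, map_smul, smul_mul_assoc]
      refine smul _ _ ?_
      cases i with
      | inl n => rw [← bOp_of_nonpos]; exact b _ _ hx
      | inr n => rw [← cOp_of_neg]; exact c _ _ hx

theorem finite_nbc_support (m : ℤ) (x : FockF) : {k | nbc k (m - k) x ≠ 0}.Finite := by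
  induction x using fock_induction with
  | one =>
    refine (Set.finite_Icc m 0).subset fun k hk => ?_
    by_contra h
    exact hk (nbc_one _ _ (by rw [Set.mem_Icc] at h; omega))
  | add x y hx hy =>
    refine (hx.union hy).subset fun k hk => ?_
    by_contra h
    simp only [Set.mem_union, Set.mem_ofPred_eq, not_or, not_not] at h
    exact hk (by rw [map_add, h.1, h.2, add_zero])
  | smul a x hx =>
    refine hx.subset fun k hk h => hk ?_
    rw [map_smul, h, smul_zero]
  | b r x hx =>
    refine (hx.union (Set.finite_singleton (m + r))).subset fun k hk => ?_
    by_contra h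
    simp only [Set.mem_union, Set.mem_ofPred_eq, not_or, not_not, Set.mem_singleton_iff] at h
    exact hk (by rw [nbc_bOp, h.1, if_neg (by omega), map_zero, add_zero])
  | c r x hx =>
    refine (hx.union (Set.finite_singleton (-r))).subset fun k hk => ?_
    by_contra h
    simp only [Set.mem_union, Set.mem_ofPred_eq, not_or, not_not, Set.mem_singleton_iff] at h
    exact hk (by rw [nbc_cOp, h.1, if_neg h.2, map_zero, sub_zero])

theorem hasFiniteSupport_smul_nbc (m : ℤ) (f : ℤ → ℂ) (x : FockF) :
    (Function.support fun k => f k • nbc k (m - k) x).Finite :=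
  (finite_nbc_support m x).subset fun k hk h => hk (by simp only [h, smul_zero])

/-- The zero mode `W̃_0` as a linear map. -/
def Wzero : Module.End ℂ FockF where
  toFun := Wmode 0
  map_add' x y := by
    simp only [Wmode, map_add, smul_add]
    exact finsum_add_distrib (hasFiniteSupport_smul_nbc 0 _ x) (hasFiniteSupport_smul_nbc 0 _ y)
  map_smul' a x := by
    simp only [Wmode, map_smul, smul_comm _ a, RingHom.id_apply]
    exact (smul_finsum' a (hasFiniteSupport_smul_nbc 0 _ x)).symm

theorem Wzero_apply (x : FockF) : Wzero x = ∑ᶠ k : ℤ, (k : ℂ) ^ 2 • nbc k (0 - k) x := by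
  refine finsum_congr fun k => ?_
  congr 1
  push_cast
  ring

theorem Wzero_one : Wzero 1 = 0 := by
  rw [Wzero_apply]
  refine finsum_eq_zero_of_forall_eq_zero fun k => ?_
  rw [nbc_one _ _ (by omega), smul_zero]

theorem Wzero_bOp (r : ℤ) (x : FockF) :
    Wzero (bOp r x) = bOp r (Wzero x) + (r : ℂ) ^ 2 • bOp r x := by
  have h (k : ℤ) : (k : ℂ) ^ 2 • nbc k (0 - k) (bOp r x) =
      bOp r ((k : ℂ) ^ 2 • nbc k (0 - k) x) + if k = r then (r : ℂ) ^ 2 • bOp r x else 0 := by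
    rw [nbc_bOp, smul_add, map_smul]
    congr 1
    by_cases hk : k = r
    · simp [hk]
    · rw [if_neg (by omega), if_neg hk, smul_zero]
  rw [Wzero_apply, finsum_congr h, finsum_add_distrib, finsum_eq_single (fun k => if k = r then _ else _) r, if_pos rfl,
    Wzero_apply, map_finsum (bOp r) (hasFiniteSupport_smul_nbc 0 _ x)]
  · intro k hk
    rw [if_neg hk]
  · refine (hasFiniteSupport_smul_nbc 0 (fun k => (k : ℂ) ^ 2) x).subset fun k hk h => hk ?_
    simp only [h, map_zero]
  · exact (Set.finite_singleton r).subset fun k hk => by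
      by_contra h
      exact hk (if_neg h)

theorem Wzero_cOp (r : ℤ) (x : FockF) :
    Wzero (cOp r x) = cOp r (Wzero x) - (r : ℂ) ^ 2 • cOp r x := by
  have h (k : ℤ) : (k : ℂ) ^ 2 • nbc k (0 - k) (cOp r x) =
      cOp r ((k : ℂ) ^ 2 • nbc k (0 - k) x) +
        if k = -r then -((r : ℂ) ^ 2 • cOp r x) else 0 := by
    rw [nbc_cOp, smul_sub, map_smul, sub_eq_add_neg]
    congr 1
    by_cases hk : k = -r
    · simp [hk]
    · rw [if_neg hk, if_neg hk, smul_zero, neg_zero]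
  rw [Wzero_apply, finsum_congr h, finsum_add_distrib, finsum_eq_single (fun k => if k = -r then _ else _) (-r), if_pos rfl,
    Wzero_apply, map_finsum (cOp r) (hasFiniteSupport_smul_nbc 0 _ x), sub_eq_add_neg]
  · intro k hk
    rw [if_neg hk]
  · refine (hasFiniteSupport_smul_nbc 0 (fun k => (k : ℂ) ^ 2) x).subset fun k hk h => hk ?_
    simp only [h, map_zero]
  · exact (Set.finite_singleton (-r)).subset fun k hk => by
      by_contra h
      exact hk (if_neg h)

theorem iSup_eigenspace_Wzero : ⨆ μ, Wzero.eigenspace μ = ⊤ := by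
  refine eq_top_iff.2 fun x hx => ?_
  clear hx
  induction x using fock_induction with
  | one => exact Submodule.mem_iSup_of_mem 0 (by simp [Wzero_one])
  | add x y hx hy => exact add_mem hx hy
  | smul a x hx => exact Submodule.smul_mem _ _ hx
  | b r x hx =>
    induction hx using Submodule.iSup_induction' with
    | mem μ x hx =>
      refine Submodule.mem_iSup_of_mem (μ + (r : ℂ) ^ 2) ?_
      rw [Module.End.mem_eigenspace_iff] at hx ⊢
      rw [Wzero_bOp, hx, map_smul, add_smul]
    | zero => simp
    | add x y _ _ hx hy =>
      rw [map_add]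
      exact add_mem hx hy
  | c r x hx =>
    induction hx using Submodule.iSup_induction' with
    | mem μ x hx =>
      refine Submodule.mem_iSup_of_mem (μ - (r : ℂ) ^ 2) ?_
      rw [Module.End.mem_eigenspace_iff] at hx ⊢
      rw [Wzero_cOp, hx, map_smul, sub_smul]
    | zero => simp
    | add x y _ _ hx hy =>
      rw [map_add]
      exact add_mem hx hy

/-- An invariant subspace contains the components of each of its elements along eigenvectors with
distinct eigenvalues. -/
theorem mem_of_sum_eigenvectors_mem {K V ι : Type*} [Field K] [AddCommGroup V] [Module K V]
    {f : Module.End K V} {U : Submodule K V} (hU : ∀ x ∈ U, f x ∈ U) {μ : ι → K} (s : Finset ι) :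
    ∀ x : ι → V, Set.InjOn μ s → (∀ i ∈ s, f (x i) = μ i • x i) → ∑ i ∈ s, x i ∈ U →
      ∀ i ∈ s, x i ∈ U := by
  classical
  induction s using Finset.induction_on with
  | empty => simp
  | insert a s ha ih =>
    intro x hμ hx hsum
    have hs : ∀ i ∈ s, x i ∈ U := by
      intro i hi
      have hne : μ i - μ a ≠ 0 := by
        refine sub_ne_zero.2 fun h => ha ?_
        have := hμ (by simp [hi]) (by simp) h
        rwa [← this]
      refine (U.smul_mem_iff hne).1 (ih (fun i => (μ i - μ a) • x i) ?_ ?_ ?_ i hi)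
      · exact hμ.mono (by simp)
      · intro j hj
        rw [map_smul, hx j (by simp [hj]), smul_comm]
      · convert U.sub_mem (hU _ hsum) (U.smul_mem (μ a) hsum) using 1
        rw [Finset.sum_insert ha, map_add, smul_add, hx a (by simp), add_sub_add_left_eq_sub,
          map_sum, Finset.smul_sum, ← Finset.sum_sub_distrib]
        refine Finset.sum_congr rfl fun j hj => ?_
        rw [hx j (by simp [hj]), sub_smul]
    intro i hi
    rcases Finset.mem_insert.1 hi with rfl | hi
    · rw [Finset.sum_insert ha] at hsum
      exact (U.add_mem_iff_left (U.sum_mem hs)).1 hsum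
    · exact hs i hi

theorem Wzero_nbc {x : FockF} {μ : ℂ} (hx : Wzero x = μ • x) (k j : ℤ) :
    Wzero (nbc k j x) = (μ + (k : ℂ) ^ 2 - (j : ℂ) ^ 2) • nbc k j x := by
  rw [nbc_apply, map_sub, Wzero_bOp, Wzero_cOp, hx]
  split_ifs with h
  · have hj : (k : ℂ) ^ 2 = (j : ℂ) ^ 2 := by rw [h.2]; push_cast; ring
    rw [hx, hj, map_sub, map_smul, map_smul, map_smul]
    module
  · rw [map_sub, map_smul, map_smul, map_smul, map_zero]
    module

/-- An eigenvector of `W̃_0` in an `(L_{-1}, W̃_0)`-invariant subspace is kept in it by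
`b(-1)c(0)`. -/
theorem bOp_cOp_mem_of_eigenvector {U : Submodule ℂ FockF} (hL : ∀ x ∈ U, Lmode (-1) x ∈ U)
    (hW : ∀ x ∈ U, Wzero x ∈ U) {x : FockF} {μ : ℂ} (hx : Wzero x = μ • x) (hxU : x ∈ U) :
    bOp (-1) (cOp 0 x) ∈ U := by
  have hfin := hasFiniteSupport_smul_nbc (-1) (fun k => -(k : ℂ)) x
  have hsum := hL x hxU
  rw [Lmode, finsum_eq_sum_of_support_subset (s := hfin.toFinset) _ (by simp)] at hsum
  have key := mem_of_sum_eigenvectors_mem hW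
    (μ := fun k : ℤ => μ + (k : ℂ) ^ 2 - ((-1 - k : ℤ) : ℂ) ^ 2) hfin.toFinset _
    (fun k _ k' _ h => by
      have h' : (k : ℂ) = k' := by
        push_cast at h
        linear_combination (-1 / 2 : ℂ) * h
      exact_mod_cast h')
    (fun k _ => by rw [map_smul, Wzero_nbc hx, smul_comm]) hsum (-1)
  have hone : (-((-1 : ℤ) : ℂ)) • nbc (-1) (-1 - -1) x = bOp (-1) (cOp 0 x) := by
    simp [nbc_apply]
  rw [hone] at key
  by_cases h0 : bOp (-1) (cOp 0 x) = 0
  · rw [h0]; exact U.zero_mem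
  · exact key (by simpa [nbc_apply] using h0)

theorem cOp_cOp_self (n : ℤ) (x : FockF) : cOp n (cOp n x) = 0 := by
  have h : (2 : ℂ) • cOp n (cOp n x) = 0 := by
    rw [two_smul, ← eq_neg_iff_add_eq_zero]
    exact cOp_cOp_swap n n x
  exact (smul_eq_zero.1 h).resolve_left two_ne_zero

theorem contractLeft_prod_of_notMem {i : BCIndex} {L : List BCIndex} (h : i ∉ L) :
    CliffordAlgebra.contractLeft (bvDual i) (L.map fun i => ι ℂ (bv i)).prod = (0 : FockF) := by
  induction L with
  | nil => exact CliffordAlgebra.contractLeft_one (Q := 0) _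
  | cons j L ih =>
    rw [List.mem_cons, not_or] at h
    rw [List.map_cons, List.prod_cons, contractLeft_ι_mul, ih h.2, bvDual_bv,
      if_neg (Ne.symm h.1), zero_smul, mul_zero, sub_zero]

theorem contractLeft_prod_cons {i : BCIndex} {L : List BCIndex} (h : i ∉ L) :
    CliffordAlgebra.contractLeft (bvDual i) ((i :: L).map fun i => ι ℂ (bv i)).prod =
      (L.map fun i => ι ℂ (bv i)).prod := by
  rw [List.map_cons, List.prod_cons, contractLeft_ι_mul, contractLeft_prod_of_notMem h, bvDual_bv,
    if_pos rfl, one_smul, mul_zero, sub_zero]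

theorem prod_ne_zero_of_nodup {L : List BCIndex} (h : L.Nodup) :
    (L.map fun i => ι ℂ (bv i)).prod ≠ 0 := by
  induction L with
  | nil => simp
  | cons i L ih =>
    rw [List.nodup_cons] at h
    intro h0
    have := contractLeft_prod_cons h.1
    rw [h0, map_zero] at this
    exact ih h.2 this.symm

theorem exists_nodup_charge (l : ℤ) :
    ∃ L : List BCIndex, chargeOf L = l ∧ L.Nodup ∧ Sum.inl 0 ∉ L ∧ Sum.inl 1 ∉ L := by
  rcases le_or_gt 0 l with h | h
  · refine ⟨(List.range l.toNat).map fun n => Sum.inl (n + 2), ?_, ?_, by simp, by simp⟩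
    · simp [chargeOf, List.countP_map, Function.comp_def, h]
    · exact List.nodup_range.map fun a b h => by simpa using h
  · refine ⟨(List.range (-l).toNat).map Sum.inr, ?_, ?_, by simp, by simp⟩
    · simp [chargeOf, List.countP_map, Function.comp_def]
      omega
    · exact List.nodup_range.map Sum.inr_injective

/-- The short exact sequence `0 → F̄^l → F^l → F̄^{l−1} → 0` of modules over the `W_3`
algebra with central charge `−2` does not split: there is no `(L_m, W̃_m)`-invariant
complement of `F̄^l` in `F^l`. -/
theorem exact_sequence_does_not_split (l : ℤ) :
    ¬ ∃ U : Submodule ℂ FockF, U ≤ FF l ∧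
        (∀ m : ℤ, ∀ x ∈ U, Lmode m x ∈ U) ∧
        (∀ m : ℤ, ∀ x ∈ U, Wmode m x ∈ U) ∧
        FFbar l ⊓ U = ⊥ ∧ FFbar l ⊔ U = FF l := by
  rintro ⟨U, hUF, hL, hW, hinf, hsup⟩
  have hW0 : ∀ x ∈ U, Wzero x ∈ U := hW 0
  have hU : ∀ x ∈ U, bOp (-1) (cOp 0 x) = 0 := by
    intro x hx
    have hxtop : x ∈ ⨆ μ, Wzero.eigenspace μ := iSup_eigenspace_Wzero ▸ Submodule.mem_top
    obtain ⟨f, hf, rfl⟩ := (Submodule.mem_iSup_iff_exists_finsupp _ _).1 hxtop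
    have hf' (μ : ℂ) : Wzero (f μ) = μ • f μ := Module.End.mem_eigenspace_iff.1 (hf μ)
    have hmem := mem_of_sum_eigenvectors_mem hW0 (μ := id) f.support f
      (Function.injective_id.injOn) (fun μ _ => hf' μ) hx
    rw [Finsupp.sum, map_sum, map_sum]
    refine Finset.sum_eq_zero fun μ hμ => ?_
    have h := bOp_cOp_mem_of_eigenvector (hL (-1)) hW0 (hf' μ) (hmem μ hμ)
    have h0 : bOp (-1) (cOp 0 (f μ)) ∈ FFbar l ⊓ U := by
      refine ⟨⟨hUF h, ?_⟩, h⟩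
      rw [SetLike.mem_coe, LinearMap.mem_ker, cOp_bOp_swap, cOp_cOp_self]
      simp
    rwa [hinf, Submodule.mem_bot] at h0
  have hF : ∀ x ∈ FF l, bOp (-1) (cOp 0 x) = 0 := by
    intro x hx
    rw [← hsup] at hx
    obtain ⟨y, hy, z, hz, rfl⟩ := Submodule.mem_sup.1 hx
    rw [map_add, map_add, hU z hz, LinearMap.mem_ker.1 hy.2, map_zero, zero_add]
  obtain ⟨L, hcharge, hnodup, h0, h1⟩ := exists_nodup_charge (l - 1)
  have h := hF _ (Submodule.subset_span ⟨Sum.inl 0 :: L, by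
    simp only [chargeOf, List.countP_cons, Sum.isLeft_inl, Sum.isRight_inl] at hcharge ⊢
    push_cast
    simp
    omega, rfl⟩)
  have hc := cOp_of_nonneg 0
  have hb := bOp_of_nonpos 1
  rw [Nat.cast_zero] at hc
  rw [Nat.cast_one] at hb
  rw [hc, contractLeft_prod_cons h0, hb] at h
  exact prod_ne_zero_of_nodup (List.nodup_cons.2 ⟨h1, hnodup⟩) (by simpa using h)
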